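/- Let p be a prime number and let f be a polynomial map of degree d ≥ 2 over ℂ_p. Suppose the Julia set J(f) is non-empty and there exists a non-empty set B ⊆ ℂ_p such that: (1) there exists λ > 1 with |f'(z)| ≥ λ for all z ∈ B; (2) f⁻¹(B) ⊆ B; (3) there exists M > 0 with B ⊆ D̄_M(0); (4) there exists δ > 0 with D̄_δ(z) ⊆ B for every z ∈ B. Then f is J-stable in Poly_d(ℂ_p): there exists ε > 0 such that for every polynomial g(z) = b_d z^d + ⋯ + b_0 over ℂ_p with b_d ≠ 0 and |a_k − b_k| < ε for all 0 ≤ k ≤ d (where f(z) = a_d z^d + ⋯ + a_0), there exists a homeomorphism h : J(f) → J(g) with h(f(z)) = g(h(z)) for all z ∈ J(f). -/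

import Mathlib

open Polynomial

noncomputable section

/-- The projective line over `K`: `K` together with a point at infinity (`none`). -/
def P1 (K : Type*) := Option K

variable {K : Type*}

/-- Inclusion of `K` into the projective line. -/
def toP1 : K → P1 K := some

/-- The point at infinity of the projective line. -/
def P1.infty : P1 K := none

/-- The extension of a polynomial map to the projective line, sending `∞` to `∞`. -/
def polyMap [CommRing K] (f : K[X]) : P1 K → P1 K :=
  fun z => Option.map (fun w => f.eval w) z

/-- The chordal metric on the projective line over a normed field. -/
def chordal [NormedField K] (x y : P1 K) : ℝ :=
  match x, y with
  | some z, some w => ‖z - w‖ / (max ‖z‖ 1 * max ‖w‖ 1)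
  | some z, none => 1 / max ‖z‖ 1
  | none, some w => 1 / max ‖w‖ 1
  | none, none => 0

/-- A subset of the projective line is `ρ`-open if around each of its points it contains a
ball with respect to the chordal metric. -/
def IsRhoOpen [NormedField K] (U : Set (P1 K)) : Prop :=
  ∀ x ∈ U, ∃ ε > 0, ∀ y, chordal x y < ε → y ∈ U

/-- The topology on the projective line induced by the chordal metric. -/
instance P1.instTopologicalSpace (K : Type*) [NormedField K] : TopologicalSpace (P1 K) where
  IsOpen := IsRhoOpen
  isOpen_univ := fun _ _ => ⟨1, one_pos, fun _ _ => trivial⟩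
  isOpen_inter := fun U V hU hV x hx => by
    obtain ⟨ε₁, hε₁, h₁⟩ := hU x hx.1
    obtain ⟨ε₂, hε₂, h₂⟩ := hV x hx.2
    exact ⟨min ε₁ ε₂, lt_min hε₁ hε₂, fun y hy =>
      ⟨h₁ y (lt_of_lt_of_le hy (min_le_left _ _)), h₂ y (lt_of_lt_of_le hy (min_le_right _ _))⟩⟩
  isOpen_sUnion := fun S hS x hx => by
    obtain ⟨U, hUS, hxU⟩ := hx
    obtain ⟨ε, hε, h⟩ := hS U hUS x hxU
    exact ⟨ε, hε, fun y hy => ⟨U, hUS, h y hy⟩⟩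

/-- The Fatou set of a polynomial map: the largest `ρ`-open subset of the projective line on
which the family of iterates is equicontinuous with respect to the chordal metric. -/
def fatou [NormedField K] (f : K[X]) : Set (P1 K) :=
  {x | ∃ U : Set (P1 K), x ∈ U ∧ IsRhoOpen U ∧
    ∀ y ∈ U, ∀ ε > 0, ∃ δ > 0, ∀ z : P1 K, chordal y z < δ →
      ∀ n : ℕ, chordal ((polyMap f)^[n] y) ((polyMap f)^[n] z) < ε}

/-- The Julia set of a polynomial map: the complement of the Fatou set. -/
def julia [NormedField K] (f : K[X]) : Set (P1 K) :=
  (fatou f)ᶜ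

/-- The dynamics of `f` and `g` on their Julia sets are conjugate: there is a homeomorphism
`h : J(f) → J(g)` with `h ∘ f = g ∘ h` on `J(f)`. -/
def JuliaConjugate [NormedField K] (f g : K[X]) : Prop :=
  ∃ h : (julia f) ≃ₜ (julia g),
    ∀ (z : P1 K) (hz : z ∈ julia f), ∃ hfz : polyMap f z ∈ julia f,
      (h ⟨polyMap f z, hfz⟩ : P1 K) = polyMap g (h ⟨z, hz⟩)

/-- `min {|l|^{1/(l-1)} : 2 ≤ l ≤ d}` where `|l|` is the `p`-adic absolute value of `l`. -/
def muFactor (p : ℕ) [Fact (Nat.Prime p)] (d : ℕ) : ℝ :=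
  sInf {x : ℝ | ∃ l : ℕ, 2 ≤ l ∧ l ≤ d ∧ x = ‖(l : ℚ_[p])‖ ^ ((1 : ℝ) / ((l : ℝ) - 1))}

section Ultrametric

variable [NormedField K] [IsUltrametricDist K]

lemma norm_sub_le_max_ultrametric (x y : K) : ‖x - y‖ ≤ max ‖x‖ ‖y‖ := by
  simpa [sub_eq_add_neg] using IsUltrametricDist.norm_add_le_max x (-y)

lemma norm_le_max_norm_sub (x y : K) : ‖x‖ ≤ max ‖x - y‖ ‖y‖ := by
  simpa using IsUltrametricDist.norm_add_le_max (x - y) y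

lemma norm_pow_sub_pow_sub_le {u v : K} {R : ℝ} (hR : 1 ≤ R) (hu : ‖u‖ ≤ R) (hv : ‖v‖ ≤ R)
    (n : ℕ) : ‖u ^ n - v ^ n - n * v ^ (n - 1) * (u - v)‖ ≤ R ^ n * ‖u - v‖ ^ 2 := by
  have hR0 : (0 : ℝ) ≤ R := zero_le_one.trans hR
  induction n with
  | zero => simp
  | succ n ih =>
    have key : u ^ (n + 1) - v ^ (n + 1) - ((n + 1 : ℕ) : K) * v ^ (n + 1 - 1) * (u - v)
        = u * (u ^ n - v ^ n - n * v ^ (n - 1) * (u - v))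
          + (n : K) * v ^ (n - 1) * (u - v) ^ 2 := by
      cases n with
      | zero => simp
      | succ m => simp only [Nat.add_sub_cancel]; push_cast; ring
    rw [key]
    refine (IsUltrametricDist.norm_add_le_max _ _).trans (max_le ?_ ?_)
    · rw [norm_mul, pow_succ']
      calc ‖u‖ * _ ≤ R * (R ^ n * ‖u - v‖ ^ 2) := by gcongr
        _ = _ := by ring
    · rw [norm_mul, norm_mul, norm_pow, norm_pow]
      have h1 : ‖(n : K)‖ ≤ 1 := IsUltrametricDist.norm_natCast_le_one K n
      have h2 : ‖v‖ ^ (n - 1) ≤ R ^ (n + 1) :=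
        (pow_le_pow_left₀ (norm_nonneg _) hv _).trans (pow_le_pow_right₀ hR (by omega))
      calc ‖(n : K)‖ * ‖v‖ ^ (n - 1) * ‖u - v‖ ^ 2 ≤ 1 * R ^ (n + 1) * ‖u - v‖ ^ 2 := by gcongr
        _ = _ := by ring

lemma norm_eval_le_of_coeff_le {g : K[X]} {d : ℕ} (hg : g.natDegree ≤ d) {C R : ℝ}
    (hC : ∀ k, ‖g.coeff k‖ ≤ C) (hR : 1 ≤ R) {z : K} (hz : ‖z‖ ≤ R) :
    ‖g.eval z‖ ≤ C * R ^ d := by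
  have hC0 : 0 ≤ C := (norm_nonneg _).trans (hC 0)
  have hR0 : (0 : ℝ) ≤ R := zero_le_one.trans hR
  rw [eval_eq_sum_range' (Nat.lt_succ_of_le hg)]
  refine IsUltrametricDist.norm_sum_le_of_forall_le_of_nonneg (by positivity) fun i hi => ?_
  rw [norm_mul, norm_pow]
  have hi' : i ≤ d := by simpa [Nat.lt_succ_iff] using hi
  have : ‖z‖ ^ i ≤ R ^ d :=
    (pow_le_pow_left₀ (norm_nonneg _) hz _).trans (pow_le_pow_right₀ hR hi')
  exact mul_le_mul (hC i) this (by positivity) hC0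

lemma norm_coeff_derivative_le {g : K[X]} {C : ℝ} (hC : ∀ k, ‖g.coeff k‖ ≤ C) (k : ℕ) :
    ‖(derivative g).coeff k‖ ≤ C := by
  rw [coeff_derivative, norm_mul]
  have h1 : ‖(k + 1 : K)‖ ≤ 1 := by
    exact_mod_cast IsUltrametricDist.norm_natCast_le_one K (k + 1)
  calc _ ≤ C * 1 := mul_le_mul (hC _) h1 (norm_nonneg _) ((norm_nonneg _).trans (hC 0))
    _ = C := mul_one C

lemma norm_eval_sub_sub_le {g : K[X]} {d : ℕ} (hg : g.natDegree ≤ d) {C R : ℝ}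
    (hC : ∀ k, ‖g.coeff k‖ ≤ C) (hR : 1 ≤ R) {u v : K} (hu : ‖u‖ ≤ R) (hv : ‖v‖ ≤ R) :
    ‖g.eval u - g.eval v - (derivative g).eval v * (u - v)‖ ≤ C * R ^ d * ‖u - v‖ ^ 2 := by
  have hC0 : 0 ≤ C := (norm_nonneg _).trans (hC 0)
  have hR0 : (0 : ℝ) ≤ R := zero_le_one.trans hR
  have hd : g.natDegree < d + 1 := Nat.lt_succ_of_le hg
  have key : g.eval u - g.eval v - (derivative g).eval v * (u - v) =
      ∑ i ∈ Finset.range (d + 1),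
        g.coeff i * (u ^ i - v ^ i - i * v ^ (i - 1) * (u - v)) := by
    have hder : (derivative g).eval v =
        ∑ i ∈ Finset.range (d + 1), g.coeff i * (i * v ^ (i - 1)) := by
      rw [derivative_eval, sum_over_range' g (by simp) _ hd]
      simp [mul_assoc]
    rw [eval_eq_sum_range' hd, eval_eq_sum_range' hd, hder, Finset.sum_mul,
      ← Finset.sum_sub_distrib, ← Finset.sum_sub_distrib]
    exact Finset.sum_congr rfl fun i _ => by ring
  rw [key]
  refine IsUltrametricDist.norm_sum_le_of_forall_le_of_nonneg (by positivity) fun i hi => ?_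
  have hi' : i ≤ d := by simpa [Nat.lt_succ_iff] using hi
  rw [norm_mul, mul_assoc C]
  refine mul_le_mul (hC i) ((norm_pow_sub_pow_sub_le hR hu hv i).trans ?_) (norm_nonneg _) hC0
  gcongr

lemma norm_prod_sub_prod_le {y w : K} {r : ℝ} (hr : 0 < r) (hyw : ‖y - w‖ ≤ r)
    (s : Multiset K) (hs : ∀ α ∈ s, r < ‖y - α‖) :
    ‖(s.map (w - ·)).prod - (s.map (y - ·)).prod‖ ≤
      ‖(s.map (y - ·)).prod‖ * (‖y - w‖ / r) := by
  induction s using Multiset.induction_on with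
  | empty => simp; positivity
  | cons α s ih =>
    have hα : r < ‖y - α‖ := hs α (Multiset.mem_cons_self _ _)
    have ih' := ih fun β hβ => hs β (Multiset.mem_cons_of_mem hβ)
    simp only [Multiset.map_cons, Multiset.prod_cons]
    set P := (s.map (w - ·)).prod
    set Q := (s.map (y - ·)).prod
    have hwα : ‖w - α‖ ≤ ‖y - α‖ := by
      have h := IsUltrametricDist.norm_add_le_max (w - y) (y - α)
      rw [sub_add_sub_cancel, norm_sub_rev w y] at h
      exact h.trans (max_le (hyw.trans hα.le) le_rfl)
    have key : (w - α) * P - (y - α) * Q = (w - α) * (P - Q) + (w - y) * Q := by ring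
    rw [key]
    refine (IsUltrametricDist.norm_add_le_max _ _).trans (max_le ?_ ?_)
    · rw [norm_mul, norm_mul, mul_assoc]
      gcongr
    · rw [norm_mul, norm_mul, norm_sub_rev w y]
      have : ‖y - w‖ ≤ ‖y - α‖ * (‖y - w‖ / r) := by
        rw [mul_div_assoc', le_div_iff₀ hr, mul_comm ‖y - α‖]
        gcongr
      calc ‖y - w‖ * ‖Q‖ ≤ (‖y - α‖ * (‖y - w‖ / r)) * ‖Q‖ := by gcongr
        _ = _ := by ring

/-- A polynomial omitting a value on a disc of radius `r` is Lipschitz there, with a constant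
controlled by its own size. -/
lemma norm_eval_sub_le_of_omits [IsAlgClosed K] (Q : K[X]) {b y w : K} {r : ℝ} (hr : 0 < r)
    (homit : ∀ x, ‖y - x‖ ≤ r → Q.eval x ≠ b) (hyw : ‖y - w‖ ≤ r) :
    ‖Q.eval w - Q.eval y‖ ≤ ‖Q.eval y - b‖ * (‖y - w‖ / r) := by
  have h1 : ∀ x, Q.eval x - b = (Q - C b).eval x := by simp
  rw [← sub_sub_sub_cancel_right _ _ b, h1, h1,
    (IsAlgClosed.splits (Q - C b)).eval_eq_prod_roots,
    (IsAlgClosed.splits (Q - C b)).eval_eq_prod_roots, ← mul_sub, norm_mul, norm_mul, mul_assoc]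
  refine mul_le_mul_of_nonneg_left (norm_prod_sub_prod_le hr hyw _ fun α hα => ?_)
    (norm_nonneg _)
  by_contra! h
  refine homit α h ?_
  have := (mem_roots'.1 hα).2
  simpa [IsRoot, sub_eq_zero] using this

/-- A Newton-type estimate: over an algebraically closed field the value `b` is attained within
distance `‖g z - b‖ / ‖g' z‖` of `z`. -/
lemma exists_eval_eq_norm_sub_le [IsAlgClosed K] (g : K[X]) (z b : K)
    (hz : (derivative g).eval z ≠ 0) :
    ∃ w, g.eval w = b ∧ ‖w - z‖ * ‖(derivative g).eval z‖ ≤ ‖g.eval z - b‖ := by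
  by_cases hb : g.eval z = b
  · exact ⟨z, hb, by simp [hb]⟩
  have hne : (g - C b).eval z ≠ 0 := by simpa [sub_eq_zero] using hb
  have h := (IsAlgClosed.splits (g - C b)).eval_derivative_div_eval_of_ne_zero hne
  obtain ⟨α, hα, hle⟩ := IsUltrametricDist.exists_norm_multiset_sum_le (g - C b).roots
    (f := fun x => 1 / (z - x))
  rw [← h] at hle
  have hroots : (g - C b).roots ≠ 0 := by
    intro h0
    rw [h0] at h
    simp only [Multiset.map_zero, Multiset.sum_zero, div_eq_zero_iff] at h
    rcases h with h | h
    · exact hz (by simpa using h)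
    · exact hne h
  have hroot := (mem_roots'.1 (hα hroots)).2
  have hαb : g.eval α = b := by simpa [IsRoot, sub_eq_zero] using hroot
  refine ⟨α, hαb, ?_⟩
  have hzα : 0 < ‖z - α‖ := by
    rw [norm_pos_iff, sub_ne_zero]
    rintro rfl
    exact hb hαb
  have hpos : 0 < ‖g.eval z - b‖ := norm_pos_iff.2 (sub_ne_zero.2 hb)
  simp only [derivative_sub, derivative_C, sub_zero, eval_sub, eval_C, norm_div, norm_one] at hle
  rw [div_le_div_iff₀ hpos hzα, one_mul, mul_comm, norm_sub_rev] at hle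
  exact hle

end Ultrametric

section Chordal

variable [NormedField K]

lemma polyMap_iterate_toP1 (f : K[X]) (n : ℕ) (x : K) :
    (polyMap f)^[n] (toP1 x) = toP1 ((fun z => f.eval z)^[n] x) :=
  ((Function.Semiconj.iterate_right (f := (toP1 : K → P1 K)) (ga := fun z => f.eval z)
    (gb := polyMap f) (fun _ => rfl) n) x).symm

lemma polyMap_iterate_infty (f : K[X]) (n : ℕ) :
    (polyMap f)^[n] P1.infty = P1.infty :=
  Function.iterate_fixed rfl n

lemma chordal_toP1 (x y : K) :
    chordal (toP1 x) (toP1 y) = ‖x - y‖ / (max ‖x‖ 1 * max ‖y‖ 1) := rfl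

lemma chordal_toP1_le (x y : K) : chordal (toP1 x) (toP1 y) ≤ ‖x - y‖ := by
  rw [chordal_toP1]
  refine div_le_self (norm_nonneg _) ?_
  exact one_le_mul_of_one_le_of_one_le (le_max_right _ _) (le_max_right _ _)

lemma exists_of_chordal_lt [IsUltrametricDist K] {x : K} {y : P1 K} {t : ℝ}
    (ht : t * max ‖x‖ 1 ≤ 1) (h : chordal (toP1 x) y < t) :
    ∃ w, y = toP1 w ∧ ‖x - w‖ < t * max ‖x‖ 1 ^ 2 := by
  have hm : 0 < max ‖x‖ 1 := lt_max_of_lt_right one_pos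
  match y, h with
  | none, h =>
    have h' : 1 / max ‖x‖ 1 < t := h
    rw [div_lt_iff₀ hm] at h'
    exact absurd h' (not_lt.2 ht)
  | some w, h =>
    have hw : 0 < max ‖w‖ 1 := lt_max_of_lt_right one_pos
    have h' : ‖x - w‖ / (max ‖x‖ 1 * max ‖w‖ 1) < t := h
    have ht0 : 0 < t := lt_of_le_of_lt (by positivity) h'
    rw [div_lt_iff₀ (by positivity)] at h'
    refine ⟨w, rfl, h'.trans_le ?_⟩
    rw [sq]
    suffices max ‖w‖ 1 ≤ max ‖x‖ 1 by gcongr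
    refine max_le ?_ (le_max_right _ _)
    by_contra! hlt
    have h1 : max ‖w‖ 1 = ‖w‖ := max_eq_left ((le_max_right _ _).trans hlt.le)
    rw [h1] at h'
    have h2 := norm_le_max_norm_sub w x
    rw [norm_sub_rev w x] at h2
    have h3 : ‖w‖ ≤ ‖x - w‖ := by
      rcases le_max_iff.1 h2 with h2 | h2
      · exact h2
      · exact absurd (h2.trans (le_max_left _ _)) (not_le.2 hlt)
    have h4 : t * (max ‖x‖ 1 * ‖w‖) ≤ 1 * ‖w‖ := by
      rw [← mul_assoc]; gcongr
    linarith

lemma isOpenEmbedding_toP1 [IsUltrametricDist K] :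
    Topology.IsOpenEmbedding (toP1 : K → P1 K) := by
  refine .of_continuous_injective_isOpenMap ?_ (Option.some_injective K) ?_
  · refine continuous_def.2 fun U hU => Metric.isOpen_iff.2 fun x hx => ?_
    obtain ⟨ε, hε, h⟩ := hU (toP1 x) hx
    refine ⟨ε, hε, fun y hy => h _ ((chordal_toP1_le x y).trans_lt ?_)⟩
    rwa [← dist_eq_norm, dist_comm]
  · intro V hV
    rintro _ ⟨x, hx, rfl⟩
    obtain ⟨ε, hε, h⟩ := Metric.isOpen_iff.1 hV x hx
    have hm : 0 < max ‖x‖ 1 := lt_max_of_lt_right one_pos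
    refine ⟨min (1 / max ‖x‖ 1) (ε / max ‖x‖ 1 ^ 2), by positivity, fun y hy => ?_⟩
    obtain ⟨w, rfl, hw⟩ := exists_of_chordal_lt
      ((le_div_iff₀ hm).1 (min_le_left _ _)) hy
    refine ⟨w, h ?_, rfl⟩
    rw [Metric.mem_ball, dist_comm, dist_eq_norm]
    exact hw.trans_le ((le_div_iff₀ (by positivity)).1 (min_le_right _ _))

end Chordal

section Survivors

variable [NormedField K]

/-- The points whose whole forward orbit under `f` stays in `B`. -/
def survivors (f : K[X]) (B : Set K) : Set K :=
  {z | ∀ n : ℕ, (fun x => f.eval x)^[n] z ∈ B}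

/-- The quantitative hypotheses, uniform on a neighbourhood of a given polynomial, under which
the Julia set of `f` is the set of points whose forward orbit stays in `B`. -/
structure ExpandingOn (B : Set K) (d : ℕ) (C R lam η : ℝ) (f : K[X]) : Prop where
  natDegree_le : f.natDegree ≤ d
  coeff_le : ∀ k, ‖f.coeff k‖ ≤ C
  one_le : 1 ≤ R
  norm_le : ∀ z ∈ B, ‖z‖ ≤ R
  one_lt : 1 < lam
  pos : 0 < η
  small : C * R ^ d * η < lam
  thick : ∀ z ∈ B, ∀ w, ‖w - z‖ ≤ η → w ∈ B
  expanding : ∀ z ∈ B, lam ≤ ‖(derivative f).eval z‖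
  backward : ∀ z, f.eval z ∈ B → z ∈ B
  escape : ∀ z, R < ‖z‖ → ‖z‖ ≤ ‖f.eval z‖

lemma eval_mem_survivors {f : K[X]} {B : Set K} {z : K} (hz : z ∈ survivors f B) :
    f.eval z ∈ survivors f B :=
  fun n => hz (n + 1)

lemma continuous_iterate_eval (f : K[X]) (n : ℕ) : Continuous (fun x => f.eval x)^[n] :=
  f.continuous.iterate n

namespace ExpandingOn

variable {B : Set K} {d : ℕ} {C R lam η : ℝ} {f g : K[X]}

lemma isClosed (h : ExpandingOn B d C R lam η f) : IsClosed B := by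
  refine ⟨Metric.isOpen_iff.2 fun x hx => ⟨η, h.pos, fun y hy hyB => hx (h.thick y hyB x ?_)⟩⟩
  rw [← dist_eq_norm, dist_comm]
  exact (Metric.mem_ball.1 hy).le

lemma isClosed_survivors (h : ExpandingOn B d C R lam η f) : IsClosed (survivors f B) := by
  have : survivors f B = ⋂ n : ℕ, (fun x => f.eval x)^[n] ⁻¹' B := by
    ext z; simp [survivors]
  rw [this]
  exact isClosed_iInter fun n => h.isClosed.preimage (continuous_iterate_eval f n)

lemma iterate_notMem (h : ExpandingOn B d C R lam η f) {z : K} (hz : z ∉ B) (n : ℕ) :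
    (fun x => f.eval x)^[n] z ∉ B := by
  induction n with
  | zero => exact hz
  | succ n ih =>
    rw [Function.iterate_succ_apply']
    exact fun hB => ih (h.backward _ hB)

lemma norm_le_norm_iterate (h : ExpandingOn B d C R lam η f) {z : K} (hz : R < ‖z‖) (n : ℕ) :
    ‖z‖ ≤ ‖(fun x => f.eval x)^[n] z‖ := by
  induction n with
  | zero => exact le_rfl
  | succ n ih =>
    rw [Function.iterate_succ_apply']
    exact ih.trans (h.escape _ (hz.trans_le ih))

lemma mem_survivors_of_shadow (hg : ExpandingOn B d C R lam η g) {z w : K}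
    (hz : z ∈ survivors f B)
    (hw : ∀ k, ‖(fun x => g.eval x)^[k] w - (fun x => f.eval x)^[k] z‖ ≤ η) :
    w ∈ survivors g B :=
  fun n => hg.thick _ (hz n) _ (hw n)

variable [IsUltrametricDist K]

lemma mul_norm_sub_le (h : ExpandingOn B d C R lam η f) {u v : K} (hv : v ∈ B)
    (huv : ‖u - v‖ ≤ η) : lam * ‖u - v‖ ≤ ‖f.eval u - f.eval v‖ := by
  rcases eq_or_ne u v with rfl | hne
  · simp
  have hpos : 0 < ‖u - v‖ := norm_pos_iff.2 (sub_ne_zero.2 hne)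
  have hC0 : 0 ≤ C := (norm_nonneg _).trans (h.coeff_le 0)
  have hR0 : 0 ≤ R := zero_le_one.trans h.one_le
  have herr := norm_eval_sub_sub_le h.natDegree_le h.coeff_le h.one_le
    (h.norm_le u (h.thick v hv u huv)) (h.norm_le v hv)
  have hlin : lam * ‖u - v‖ ≤ ‖(derivative f).eval v * (u - v)‖ := by
    rw [norm_mul]
    gcongr
    exact h.expanding v hv
  have hlt : C * R ^ d * ‖u - v‖ ^ 2 < lam * ‖u - v‖ := by
    calc C * R ^ d * ‖u - v‖ ^ 2 = C * R ^ d * ‖u - v‖ * ‖u - v‖ := by ring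
      _ ≤ C * R ^ d * η * ‖u - v‖ := by gcongr
      _ < lam * ‖u - v‖ := by gcongr; exact h.small
  have hmax := norm_le_max_norm_sub ((derivative f).eval v * (u - v)) (f.eval u - f.eval v)
  rw [norm_sub_rev] at hmax
  rcases le_max_iff.1 (hlin.trans hmax) with h' | h'
  · linarith
  · exact h'

lemma pow_mul_norm_sub_le (h : ExpandingOn B d C R lam η f) {u v : K} (n : ℕ)
    (hB : ∀ k ≤ n, (fun x => f.eval x)^[k] v ∈ B)
    (hη : ∀ k ≤ n, ‖(fun x => f.eval x)^[k] u - (fun x => f.eval x)^[k] v‖ ≤ η) :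
    lam ^ n * ‖u - v‖ ≤ η := by
  have hlam : 0 ≤ lam := zero_le_one.trans h.one_lt.le
  have key : ∀ k ≤ n, lam ^ k * ‖u - v‖ ≤
      ‖(fun x => f.eval x)^[k] u - (fun x => f.eval x)^[k] v‖ := by
    intro k
    induction k with
    | zero => simp
    | succ k ih =>
      intro hk
      rw [Function.iterate_succ_apply', Function.iterate_succ_apply', pow_succ', mul_assoc]
      refine le_trans ?_ (h.mul_norm_sub_le (hB k (by omega)) (hη k (by omega)))
      gcongr
      exact ih (by omega)
  exact (key n le_rfl).trans (hη n le_rfl)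

lemma eq_of_forall_norm_sub_le (h : ExpandingOn B d C R lam η f) {u v : K}
    (hv : v ∈ survivors f B)
    (hη : ∀ k, ‖(fun x => f.eval x)^[k] u - (fun x => f.eval x)^[k] v‖ ≤ η) : u = v := by
  by_contra hne
  have hpos : 0 < ‖u - v‖ := norm_pos_iff.2 (sub_ne_zero.2 hne)
  obtain ⟨n, hn⟩ := pow_unbounded_of_one_lt (η / ‖u - v‖) h.one_lt
  rw [div_lt_iff₀ hpos] at hn
  exact absurd (h.pow_mul_norm_sub_le n (fun k _ => hv k) fun k _ => hη k) (not_le.2 hn)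

end ExpandingOn

end Survivors

section JuliaSet

variable [NormedField K]

/-- Equicontinuity at `y` of the family of iterates of `f`, for the chordal metric. -/
def EquicontIteratesAt (f : K[X]) (y : P1 K) : Prop :=
  ∀ ε > 0, ∃ δ > 0, ∀ z : P1 K, chordal y z < δ →
    ∀ n : ℕ, chordal ((polyMap f)^[n] y) ((polyMap f)^[n] z) < ε

lemma ExpandingOn.equicontIteratesAt_infty {B : Set K} {d : ℕ} {C R lam η : ℝ} {f : K[X]}
    (h : ExpandingOn B d C R lam η f) :
    EquicontIteratesAt f P1.infty := by
  intro ε hε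
  have hR : 0 < R := one_pos.trans_le h.one_le
  refine ⟨min (1 / R) ε, by positivity, fun z hz n => ?_⟩
  match z, hz with
  | none, _ =>
    change chordal ((polyMap f)^[n] P1.infty) ((polyMap f)^[n] P1.infty) < ε
    rw [polyMap_iterate_infty]
    exact hε
  | some w, hz =>
    have hz : 1 / max ‖w‖ 1 < min (1 / R) ε := hz
    have hw : R < ‖w‖ := by
      have h1 := (one_div_lt_one_div (lt_max_of_lt_right one_pos) hR).1
        (hz.trans_le (min_le_left _ _))
      rcases lt_max_iff.1 h1 with h1 | h1
      · exact h1
      · exact absurd h1 (not_lt.2 h.one_le)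
    change chordal ((polyMap f)^[n] P1.infty) ((polyMap f)^[n] (toP1 w)) < ε
    rw [polyMap_iterate_infty, polyMap_iterate_toP1]
    change 1 / max ‖(fun x => f.eval x)^[n] w‖ 1 < ε
    refine lt_of_le_of_lt ?_ (hz.trans_le (min_le_right _ _))
    have := h.norm_le_norm_iterate hw n
    gcongr

variable [IsUltrametricDist K]

lemma equicontIteratesAt_toP1 {f : K[X]} {x : K}
    (h : ∀ ε > 0, ∃ δ > 0, ∀ w, ‖x - w‖ < δ → ∀ n : ℕ,
      chordal (toP1 ((fun x => f.eval x)^[n] x)) (toP1 ((fun x => f.eval x)^[n] w)) < ε) :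
    EquicontIteratesAt f (toP1 x) := by
  intro ε hε
  obtain ⟨δ, hδ, h⟩ := h ε hε
  have hm : 0 < max ‖x‖ 1 := lt_max_of_lt_right one_pos
  refine ⟨min (1 / max ‖x‖ 1) (δ / max ‖x‖ 1 ^ 2), by positivity, fun z hz n => ?_⟩
  obtain ⟨w, rfl, hw⟩ := exists_of_chordal_lt ((le_div_iff₀ hm).1 (min_le_left _ _)) hz
  rw [polyMap_iterate_toP1, polyMap_iterate_toP1]
  exact h w (hw.trans_le ((le_div_iff₀ (by positivity)).1 (min_le_right _ _))) n

lemma equicontIteratesAt_of_eval {f : K[X]} {x : K}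
    (h : EquicontIteratesAt f (toP1 (f.eval x))) : EquicontIteratesAt f (toP1 x) := by
  refine equicontIteratesAt_toP1 fun ε hε => ?_
  obtain ⟨δ, hδ, h⟩ := h ε hε
  obtain ⟨δ', hδ', hcont⟩ := Metric.continuous_iff.1 f.continuous x δ hδ
  refine ⟨min δ' ε, lt_min hδ' hε, fun w hw n => ?_⟩
  cases n with
  | zero => exact (chordal_toP1_le _ _).trans_lt (hw.trans_le (min_le_right _ _))
  | succ n =>
    have hfw : dist (f.eval w) (f.eval x) < δ := by
      refine hcont w ?_
      rw [dist_comm, dist_eq_norm]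
      exact hw.trans_le (min_le_left _ _)
    rw [dist_comm, dist_eq_norm] at hfw
    have := h (toP1 (f.eval w)) ((chordal_toP1_le _ _).trans_lt hfw) n
    rwa [polyMap_iterate_toP1, polyMap_iterate_toP1] at this

namespace ExpandingOn

variable {B : Set K} {d : ℕ} {C R lam η : ℝ} {f g : K[X]}

lemma equicontIteratesAt_of_notMem [IsAlgClosed K] (h : ExpandingOn B d C R lam η f)
    (hB : B.Nonempty) {x : K} (hx : x ∉ B) : EquicontIteratesAt f (toP1 x) := by
  obtain ⟨b, hb⟩ := hB
  have hη := h.pos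
  have hbm : 0 < max ‖b‖ 1 := lt_max_of_lt_right one_pos
  refine equicontIteratesAt_toP1 fun ε hε =>
    ⟨min η (ε * η / max ‖b‖ 1), by positivity, fun w hw n => ?_⟩
  have hwη : ‖x - w‖ ≤ η := hw.le.trans (min_le_left _ _)
  have hwε := hw.trans_le (min_le_right _ _)
  rw [lt_div_iff₀ hbm] at hwε
  have heval : ∀ y, (f.comp^[n] X).eval y = (fun x => f.eval x)^[n] y := by
    intro y; rw [iterate_comp_eval, eval_X]
  have hlip := norm_eval_sub_le_of_omits (f.comp^[n] X) (b := b) (y := x) (w := w) hη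
    (fun y hy hyb => by
      have hyB : y ∉ B := fun hyB => hx (h.thick y hyB x hy)
      rw [heval] at hyb
      exact h.iterate_notMem hyB n (hyb ▸ hb)) hwη
  rw [heval, heval] at hlip
  set P := (fun x => f.eval x)^[n] x
  set Q := (fun x => f.eval x)^[n] w
  have hP : 0 < max ‖P‖ 1 := lt_max_of_lt_right one_pos
  have hQ : 1 ≤ max ‖Q‖ 1 := le_max_right _ _
  have hPb : ‖P - b‖ ≤ max ‖P‖ 1 * max ‖b‖ 1 := by
    refine (norm_sub_le_max_ultrametric P b).trans (max_le ?_ ?_)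
    · exact (le_max_left _ _).trans (le_mul_of_one_le_right hP.le (le_max_right _ _))
    · exact (le_max_left _ _).trans (le_mul_of_one_le_left hbm.le (le_max_right _ _))
  rw [chordal_toP1, div_lt_iff₀ (by positivity), norm_sub_rev]
  calc ‖Q - P‖ ≤ ‖P - b‖ * (‖x - w‖ / η) := hlip
    _ ≤ (max ‖P‖ 1 * max ‖b‖ 1) * (‖x - w‖ / η) := by gcongr
    _ = max ‖P‖ 1 * (‖x - w‖ * max ‖b‖ 1 / η) := by ring
    _ < max ‖P‖ 1 * ε := by gcongr; rwa [div_lt_iff₀ hη]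
    _ ≤ ε * (max ‖P‖ 1 * max ‖Q‖ 1) := by
      rw [mul_comm, ← mul_assoc]
      exact le_mul_of_one_le_right (by positivity) hQ

lemma equicontIteratesAt_of_notMem_survivors [IsAlgClosed K] (h : ExpandingOn B d C R lam η f)
    (hB : B.Nonempty) {x : K} (hx : x ∉ survivors f B) : EquicontIteratesAt f (toP1 x) := by
  simp only [survivors, Set.mem_ofPred_eq, not_forall] at hx
  obtain ⟨n, hn⟩ := hx
  induction n generalizing x with
  | zero => exact h.equicontIteratesAt_of_notMem hB hn
  | succ n ih => exact equicontIteratesAt_of_eval (ih hn)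

lemma isRhoOpen_compl_survivors (h : ExpandingOn B d C R lam η f) :
    IsRhoOpen (toP1 '' survivors f B)ᶜ := by
  have hR : 0 < R := one_pos.trans_le h.one_le
  intro y hy
  match y, hy with
  | none, _ =>
    refine ⟨1 / R, by positivity, ?_⟩
    rintro _ hz ⟨w, hw, rfl⟩
    have hz : 1 / max ‖w‖ 1 < 1 / R := hz
    rw [one_div_lt_one_div (lt_max_of_lt_right one_pos) hR] at hz
    exact absurd hz (not_lt.2 (max_le (h.norm_le w (hw 0)) h.one_le))
  | some x, hy =>
    have hopen : IsRhoOpen (toP1 '' (survivors f B)ᶜ) :=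
      isOpenEmbedding_toP1.isOpenMap _ h.isClosed_survivors.isOpen_compl
    have hx : x ∈ (survivors f B)ᶜ := fun hx => hy ⟨x, hx, rfl⟩
    obtain ⟨ε, hε, hsub⟩ := hopen (toP1 x) ⟨x, hx, rfl⟩
    refine ⟨ε, hε, fun z hz => ?_⟩
    obtain ⟨w, hw, rfl⟩ := hsub z hz
    rintro ⟨w', hw', heq⟩
    exact hw (Option.some_injective K heq ▸ hw')

lemma toP1_mem_julia (h : ExpandingOn B d C R lam η f)
    (hK : ∀ r > 0, ∃ x : K, x ≠ 0 ∧ ‖x‖ < r) {z : K} (hz : z ∈ survivors f B) :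
    toP1 z ∈ julia f := by
  rintro ⟨U, hzU, -, hU⟩
  have hη := h.pos
  have hR : 0 < R := one_pos.trans_le h.one_le
  obtain ⟨δ, hδ, hE⟩ := hU _ hzU (min (1 / R) (η / R ^ 2)) (by positivity)
  obtain ⟨x, hx0, hx⟩ := hK δ hδ
  have hch : chordal (toP1 z) (toP1 (z + x)) < δ :=
    (chordal_toP1_le _ _).trans_lt (by simpa using hx)
  have heq : z + x = z := by
    refine h.eq_of_forall_norm_sub_le hz fun n => ?_
    have hn := hE _ hch n
    rw [polyMap_iterate_toP1, polyMap_iterate_toP1] at hn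
    have hm : max ‖(fun x => f.eval x)^[n] z‖ 1 ≤ R := max_le (h.norm_le _ (hz n)) h.one_le
    obtain ⟨w, hw, hlt⟩ := exists_of_chordal_lt (by
      calc _ ≤ 1 / R * R := by gcongr; exact min_le_left _ _
        _ = 1 := by field_simp) hn
    rw [Option.some_injective K hw, norm_sub_rev]
    refine hlt.le.trans ?_
    calc _ ≤ η / R ^ 2 * R ^ 2 := by gcongr; exact min_le_right _ _
      _ = η := by field_simp
  exact hx0 (by simpa using heq)

lemma image_survivors_eq_julia [IsAlgClosed K] (h : ExpandingOn B d C R lam η f)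
    (hB : B.Nonempty) (hK : ∀ r > 0, ∃ x : K, x ≠ 0 ∧ ‖x‖ < r) :
    toP1 '' survivors f B = julia f := by
  refine Set.Subset.antisymm ?_ fun y hy => ?_
  · rintro _ ⟨z, hz, rfl⟩
    exact h.toP1_mem_julia hK hz
  · by_contra hyS
    refine hy ⟨_, hyS, h.isRhoOpen_compl_survivors, fun z hz => ?_⟩
    match z, hz with
    | none, _ => exact h.equicontIteratesAt_infty
    | some x, hz =>
      exact h.equicontIteratesAt_of_notMem_survivors hB fun hx => hz ⟨x, hx, rfl⟩

end ExpandingOn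

end JuliaSet

section Shadowing

variable [NormedField K] [IsUltrametricDist K]

namespace ExpandingOn

variable {B : Set K} {d : ℕ} {C R lam η : ℝ} {f g : K[X]}

lemma exists_shadow_upto [IsAlgClosed K] (hg : ExpandingOn B d C R lam η g)
    (hfg : ∀ z ∈ B, ‖f.eval z - g.eval z‖ ≤ η) (n : ℕ) {z : K} (hz : z ∈ survivors f B) :
    ∃ w, ∀ k ≤ n, ‖(fun x => g.eval x)^[k] w - (fun x => f.eval x)^[k] z‖ ≤ η := by
  induction n generalizing z with
  | zero =>
    refine ⟨z, fun k hk => ?_⟩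
    obtain rfl : k = 0 := by omega
    simpa using hg.pos.le
  | succ n ih =>
    obtain ⟨w', hw'⟩ := ih (eval_mem_survivors hz)
    have hlam : 0 < lam := one_pos.trans hg.one_lt
    have hder := hg.expanding z (hz 0)
    obtain ⟨w, rfl, hw⟩ := exists_eval_eq_norm_sub_le g z w'
      (norm_pos_iff.1 (hlam.trans_le hder))
    refine ⟨w, fun k hk => ?_⟩
    cases k with
    | zero =>
      have h1 : ‖g.eval z - g.eval w‖ ≤ η := by
        have := IsUltrametricDist.norm_add_le_max (g.eval z - f.eval z) (f.eval z - g.eval w)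
        rw [sub_add_sub_cancel] at this
        refine this.trans (max_le ?_ ?_)
        · rw [norm_sub_rev]; exact hfg z (hz 0)
        · rw [norm_sub_rev]; exact hw' 0 (Nat.zero_le n)
      calc ‖w - z‖ ≤ ‖w - z‖ * ‖(derivative g).eval z‖ :=
            le_mul_of_one_le_right (norm_nonneg _) (hg.one_lt.le.trans hder)
        _ ≤ η := hw.trans h1
    | succ k => exact hw' k (by omega)

lemma exists_shadow [IsAlgClosed K] [CompleteSpace K] (hg : ExpandingOn B d C R lam η g)
    (hfg : ∀ z ∈ B, ‖f.eval z - g.eval z‖ ≤ η) {z : K} (hz : z ∈ survivors f B) :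
    ∃ w ∈ survivors g B,
      ∀ k, ‖(fun x => g.eval x)^[k] w - (fun x => f.eval x)^[k] z‖ ≤ η := by
  choose w hw using fun n => hg.exists_shadow_upto hfg n hz
  have hlam : 0 < lam := one_pos.trans hg.one_lt
  have hcauchy : CauchySeq w := by
    refine cauchySeq_of_le_tendsto_0 (fun n => η / lam ^ n) (fun n m N hn hm => ?_)
      (tendsto_const_nhds.div_atTop (tendsto_pow_atTop_atTop_of_one_lt hg.one_lt))
    rw [dist_eq_norm, le_div_iff₀ (by positivity), mul_comm]
    refine hg.pow_mul_norm_sub_le N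
      (fun k hk => hg.thick _ (hz k) _ (hw m k (hk.trans hm))) fun k hk => ?_
    rw [← sub_sub_sub_cancel_right _ _ ((fun x => f.eval x)^[k] z)]
    exact (norm_sub_le_max_ultrametric _ _).trans
      (max_le (hw n k (hk.trans hn)) (hw m k (hk.trans hm)))
  obtain ⟨w₀, hw₀⟩ := cauchySeq_tendsto_of_complete hcauchy
  have hshadow : ∀ k, ‖(fun x => g.eval x)^[k] w₀ - (fun x => f.eval x)^[k] z‖ ≤ η := by
    intro k
    refine le_of_tendsto ((((continuous_iterate_eval g k).tendsto w₀).comp hw₀).sub_const _).norm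
      (Filter.eventually_atTop.2 ⟨k, fun n hn => hw n k hn⟩)
  exact ⟨w₀, hg.mem_survivors_of_shadow hz hshadow, hshadow⟩

lemma continuous_of_shadow (hg : ExpandingOn B d C R lam η g)
    {φ : survivors f B → survivors g B}
    (hφ : ∀ (z : survivors f B) (k : ℕ),
      ‖(fun x => g.eval x)^[k] (φ z : K) - (fun x => f.eval x)^[k] (z : K)‖ ≤ η) :
    Continuous φ := by
  have hlam : 0 < lam := one_pos.trans hg.one_lt
  refine Metric.continuous_iff'.2 fun z ε hε => ?_
  obtain ⟨n, hn⟩ := pow_unbounded_of_one_lt (η / ε) hg.one_lt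
  have hnear : ∀ᶠ z' : survivors f B in nhds z, ∀ k ∈ Finset.range (n + 1),
      dist ((fun x => f.eval x)^[k] (z' : K)) ((fun x => f.eval x)^[k] (z : K)) < η := by
    refine (Filter.eventually_all_finset _).2 fun k _ => ?_
    exact Metric.continuous_iff'.1
      ((continuous_iterate_eval f k).comp continuous_subtype_val) z η hg.pos
  filter_upwards [hnear] with z' hz'
  have key := hg.pow_mul_norm_sub_le (u := (φ z' : K)) (v := (φ z : K)) n
    (fun k _ => (φ z).2 k) fun k hk => by
      have h1 := hz' k (Finset.mem_range.2 (Nat.lt_succ_of_le hk))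
      rw [dist_eq_norm] at h1
      have h2 := IsUltrametricDist.norm_add_le_max
        ((fun x => g.eval x)^[k] (φ z' : K) - (fun x => f.eval x)^[k] (z' : K))
        ((fun x => f.eval x)^[k] (z' : K) - (fun x => g.eval x)^[k] (φ z : K))
      have h3 := IsUltrametricDist.norm_add_le_max
        ((fun x => f.eval x)^[k] (z' : K) - (fun x => f.eval x)^[k] (z : K))
        ((fun x => f.eval x)^[k] (z : K) - (fun x => g.eval x)^[k] (φ z : K))
      rw [sub_add_sub_cancel] at h2 h3
      have h4 := hφ z k
      rw [norm_sub_rev] at h4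
      exact h2.trans (max_le (hφ z' k) (h3.trans (max_le h1.le h4)))
  rw [div_lt_iff₀ hε] at hn
  rw [Subtype.dist_eq, dist_eq_norm]
  by_contra! hle
  have : lam ^ n * ε ≤ lam ^ n * ‖(φ z' : K) - φ z‖ := by gcongr
  linarith

lemma exists_homeomorph_shadow [IsAlgClosed K] [CompleteSpace K]
    (hf : ExpandingOn B d C R lam η f) (hg : ExpandingOn B d C R lam η g)
    (hfg : ∀ z ∈ B, ‖f.eval z - g.eval z‖ ≤ η) :
    ∃ φ : survivors f B ≃ₜ survivors g B, ∀ (z : survivors f B) (k : ℕ),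
      ‖(fun x => g.eval x)^[k] (φ z : K) - (fun x => f.eval x)^[k] (z : K)‖ ≤ η := by
  have hgf : ∀ z ∈ B, ‖g.eval z - f.eval z‖ ≤ η := fun z hz => by
    rw [norm_sub_rev]; exact hfg z hz
  choose φ hφm hφ using fun z : survivors f B => hg.exists_shadow hfg z.2
  choose ψ hψm hψ using fun z : survivors g B => hf.exists_shadow hgf z.2
  refine ⟨⟨⟨fun z => ⟨φ z, hφm z⟩, fun z => ⟨ψ z, hψm z⟩, fun z => ?_, fun z => ?_⟩,
    hg.continuous_of_shadow hφ, hf.continuous_of_shadow hψ⟩, hφ⟩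
  · refine Subtype.ext (hf.eq_of_forall_norm_sub_le z.2 fun k => ?_)
    rw [← sub_add_sub_cancel _ ((fun x => g.eval x)^[k] (φ z)) _]
    exact (IsUltrametricDist.norm_add_le_max _ _).trans
      (max_le (hψ ⟨φ z, hφm z⟩ k) (hφ z k))
  · refine Subtype.ext (hg.eq_of_forall_norm_sub_le z.2 fun k => ?_)
    rw [← sub_add_sub_cancel _ ((fun x => f.eval x)^[k] (ψ z)) _]
    exact (IsUltrametricDist.norm_add_le_max _ _).trans
      (max_le (hφ ⟨ψ z, hψm z⟩ k) (hψ z k))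

lemma juliaConjugate [IsAlgClosed K] [CompleteSpace K]
    (hf : ExpandingOn B d C R lam η f) (hg : ExpandingOn B d C R lam η g) (hB : B.Nonempty)
    (hK : ∀ r > 0, ∃ x : K, x ≠ 0 ∧ ‖x‖ < r)
    (hfg : ∀ z ∈ B, ‖f.eval z - g.eval z‖ ≤ η) : JuliaConjugate f g := by
  obtain ⟨φ, hφ⟩ := hf.exists_homeomorph_shadow hg hfg
  rw [JuliaConjugate, ← hf.image_survivors_eq_julia hB hK, ← hg.image_survivors_eq_julia hB hK]
  have hemb := (isOpenEmbedding_toP1 (K := K)).isEmbedding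
  set a := hemb.homeomorphImage (survivors f B)
  set b := hemb.homeomorphImage (survivors g B)
  refine ⟨(a.symm.trans φ).trans b, ?_⟩
  rintro _ ⟨z, hz, rfl⟩
  have hfz := eval_mem_survivors hz
  refine ⟨⟨_, hfz, rfl⟩, ?_⟩
  have ha : ∀ (x : K) (hx : x ∈ survivors f B),
      a.symm ⟨toP1 x, Set.mem_image_of_mem _ hx⟩ = ⟨x, hx⟩ := fun x hx =>
    a.symm_apply_eq.2 rfl
  have hconj : (φ ⟨f.eval z, hfz⟩ : K) = g.eval (φ ⟨z, hz⟩ : K) := by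
    refine hg.eq_of_forall_norm_sub_le (eval_mem_survivors (φ ⟨z, hz⟩).2) fun k => ?_
    rw [← sub_sub_sub_cancel_right _ _ ((fun x => f.eval x)^[k] (f.eval z))]
    exact (norm_sub_le_max_ultrametric _ _).trans
      (max_le (hφ ⟨f.eval z, hfz⟩ k) (hφ ⟨z, hz⟩ (k + 1)))
  change (b (φ (a.symm ⟨toP1 (f.eval z), _⟩)) : P1 K)
    = polyMap g (b (φ (a.symm ⟨toP1 z, _⟩)) : P1 K)
  rw [ha _ hfz, ha _ hz]
  change toP1 (φ ⟨f.eval z, hfz⟩ : K) = toP1 (g.eval (φ ⟨z, hz⟩ : K))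
  rw [hconj]

end ExpandingOn

end Shadowing

section Perturbation

variable [NormedField K] {d : ℕ} {f g : K[X]} {ε R : ℝ}

lemma norm_coeff_sub_le (hf : f.natDegree ≤ d) (hg : g.natDegree ≤ d) (hε : 0 ≤ ε)
    (hfg : ∀ k ≤ d, ‖f.coeff k - g.coeff k‖ < ε) (k : ℕ) : ‖(f - g).coeff k‖ ≤ ε := by
  rcases le_or_gt k d with hk | hk
  · rw [coeff_sub]; exact (hfg k hk).le
  · rw [coeff_eq_zero_of_natDegree_lt (((natDegree_sub_le _ _).trans (max_le hf hg)).trans_lt hk)]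
    simpa using hε

variable [IsUltrametricDist K]

lemma norm_eval_sub_eval_le (hf : f.natDegree ≤ d) (hg : g.natDegree ≤ d) (hε : 0 ≤ ε)
    (hfg : ∀ k ≤ d, ‖f.coeff k - g.coeff k‖ < ε) (hR : 1 ≤ R) {z : K} (hz : ‖z‖ ≤ R) :
    ‖f.eval z - g.eval z‖ ≤ ε * R ^ d := by
  rw [← eval_sub]
  exact norm_eval_le_of_coeff_le ((natDegree_sub_le _ _).trans (max_le hf hg))
    (norm_coeff_sub_le hf hg hε hfg) hR hz

lemma norm_eval_derivative_sub_le (hf : f.natDegree ≤ d) (hg : g.natDegree ≤ d) (hε : 0 ≤ ε)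
    (hfg : ∀ k ≤ d, ‖f.coeff k - g.coeff k‖ < ε) (hR : 1 ≤ R) {z : K} (hz : ‖z‖ ≤ R) :
    ‖(derivative f).eval z - (derivative g).eval z‖ ≤ ε * R ^ d := by
  rw [← eval_sub, ← derivative_sub]
  refine norm_eval_le_of_coeff_le ?_
    (norm_coeff_derivative_le (norm_coeff_sub_le hf hg hε hfg)) hR hz
  exact (natDegree_derivative_le _).trans
    ((Nat.sub_le _ _).trans ((natDegree_sub_le _ _).trans (max_le hf hg)))

lemma norm_le_norm_eval_of_lt {C c : ℝ} (hd : 2 ≤ d) (hg : g.natDegree ≤ d)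
    (hc : c = ‖g.coeff d‖) (hc0 : 0 < c) (hC : ∀ k, ‖g.coeff k‖ ≤ C) (hR : 1 ≤ R)
    (hRC : C < c * R) (hRc : 1 ≤ c * R) {z : K} (hz : R < ‖z‖) : ‖z‖ ≤ ‖g.eval z‖ := by
  have hz1 : 1 ≤ ‖z‖ := hR.trans hz.le
  have hz0 : 0 < ‖z‖ := one_pos.trans_le hz1
  have hC0 : 0 ≤ C := (norm_nonneg _).trans (hC 0)
  have hpow : ‖z‖ ^ d = ‖z‖ * ‖z‖ ^ (d - 1) := by
    rw [← pow_succ']; congr 1; omega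
  have hcR : c * R ≤ c * ‖z‖ := by gcongr
  have hsum := eval_eq_sum_range' (Nat.lt_succ_of_le hg) z
  rw [Finset.sum_range_succ] at hsum
  set S := ∑ i ∈ Finset.range d, g.coeff i * z ^ i
  have hS : ‖S‖ ≤ C * ‖z‖ ^ (d - 1) := by
    refine IsUltrametricDist.norm_sum_le_of_forall_le_of_nonneg (by positivity) fun i hi => ?_
    rw [norm_mul, norm_pow]
    have hi := Finset.mem_range.1 hi
    exact mul_le_mul (hC i) (pow_le_pow_right₀ hz1 (by omega)) (by positivity) hC0
  have hlead : ‖g.coeff d * z ^ d‖ = c * ‖z‖ * ‖z‖ ^ (d - 1) := by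
    rw [norm_mul, norm_pow, hpow, hc, mul_assoc]
  have hlt : ‖S‖ < c * ‖z‖ * ‖z‖ ^ (d - 1) :=
    hS.trans_lt (by gcongr; exact hRC.trans_le hcR)
  have hmax := norm_sub_le_max_ultrametric (g.eval z) S
  rw [hsum, add_sub_cancel_left, ← hsum, hlead] at hmax
  have hge : c * ‖z‖ * ‖z‖ ^ (d - 1) ≤ ‖g.eval z‖ := by
    rcases le_max_iff.1 hmax with h | h
    · exact h
    · exact absurd h (not_le.2 hlt)
  refine le_trans ?_ hge
  calc ‖z‖ ≤ ‖z‖ ^ (d - 1) := le_self_pow₀ hz1 (by omega)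
    _ ≤ c * ‖z‖ * ‖z‖ ^ (d - 1) := le_mul_of_one_le_left (by positivity) (hRc.trans hcR)

lemma expandingOn_of_close {B : Set K} {C c lam η : ℝ} (hd : 2 ≤ d) (hf : f.natDegree = d)
    (hg : g.natDegree = d) (hc : c = ‖f.coeff d‖) (hC : ∀ k ≤ d, ‖f.coeff k‖ ≤ C)
    (hR : 1 ≤ R) (hRC : C < c * R) (hRc : 1 ≤ c * R) (hBR : ∀ z ∈ B, ‖z‖ ≤ R)
    (hlam : 1 < lam) (hη : 0 < η) (hsmall : C * R ^ d * η < lam)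
    (hthick : ∀ z ∈ B, ∀ w, ‖w - z‖ ≤ η → w ∈ B)
    (hexp : ∀ z ∈ B, lam ≤ ‖(derivative f).eval z‖) (hinv : ∀ z, f.eval z ∈ B → z ∈ B)
    (hεc : ε ≤ c) (hεη : ε * R ^ d ≤ η) (hεlam : ε * R ^ d < lam)
    (hfg : ∀ k ≤ d, ‖f.coeff k - g.coeff k‖ < ε) : ExpandingOn B d C R lam η g := by
  have hε : 0 < ε := (norm_nonneg _).trans_lt (hfg d le_rfl)
  have hc0 : 0 < c := hε.trans_le hεc
  have hcC : c ≤ C := hc ▸ hC d le_rfl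
  have hgC : ∀ k, ‖g.coeff k‖ ≤ C := by
    intro k
    rcases le_or_gt k d with hk | hk
    · have h := norm_le_max_norm_sub (g.coeff k) (f.coeff k)
      rw [norm_sub_rev] at h
      exact h.trans (max_le ((hfg k hk).le.trans (hεc.trans hcC)) (hC k hk))
    · rw [coeff_eq_zero_of_natDegree_lt (hg ▸ hk), norm_zero]
      exact hc0.le.trans hcC
  have hgc : c = ‖g.coeff d‖ := by
    have hd' := hfg d le_rfl
    have h1 := norm_le_max_norm_sub (f.coeff d) (g.coeff d)
    have h2 := norm_le_max_norm_sub (g.coeff d) (f.coeff d)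
    rw [norm_sub_rev] at h2
    rw [← hc] at h1 h2
    refine le_antisymm ?_ (h2.trans (max_le (hd'.le.trans hεc) le_rfl))
    rcases le_max_iff.1 h1 with h | h
    · linarith
    · exact h
  have hesc : ∀ z, R < ‖z‖ → ‖z‖ ≤ ‖g.eval z‖ := fun z hz =>
    norm_le_norm_eval_of_lt hd hg.le hgc hc0 hgC hR hRC hRc hz
  refine ⟨hg.le, hgC, hR, hBR, hlam, hη, hsmall, hthick, fun z hz => ?_, fun z hz => ?_, hesc⟩
  · have h1 := norm_eval_derivative_sub_le hf.le hg.le hε.le hfg hR (hBR z hz)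
    have h2 := (hexp z hz).trans
      (norm_le_max_norm_sub ((derivative f).eval z) ((derivative g).eval z))
    rcases le_max_iff.1 h2 with h | h
    · linarith
    · exact h
  · have hzR : ‖z‖ ≤ R := by
      by_contra! hlt
      exact absurd ((hesc z hlt).trans (hBR _ hz)) (not_le.2 hlt)
    exact hinv z (hthick _ hz _
      ((norm_eval_sub_eval_le hf.le hg.le hε.le hfg hR hzR).trans hεη))

end Perturbation

/-- **Theorem 2.** If a polynomial map `f` of degree `d ≥ 2` over `ℂ_p` has non-empty Julia
set and admits a non-empty set `B ⊆ ℂ_p` on which it is immediately expanding, which is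
backward invariant, bounded, and thick (contains a `δ`-ball around each of its points),
then `f` is `J`-stable in `Poly_d(ℂ_p)`. -/
theorem j_stable_of_expanding_invariant_set
    {p : ℕ} [Fact (Nat.Prime p)] {K : Type*} [NormedField K] [IsAlgClosed K]
    [CompleteSpace K] [IsUltrametricDist K] [Algebra ℚ_[p] K]
    (hext : ∀ q : ℚ_[p], ‖algebraMap ℚ_[p] K q‖ = ‖q‖)
    (d : ℕ) (hd : 2 ≤ d) (f : K[X]) (hdeg : f.natDegree = d)
    (hJ : (julia f).Nonempty)
    (B : Set K) (hB : B.Nonempty)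
    (hexp : ∃ lam : ℝ, 1 < lam ∧ ∀ z ∈ B, lam ≤ ‖(derivative f).eval z‖)
    (hinv : (fun z => f.eval z) ⁻¹' B ⊆ B)
    (hbdd : ∃ M : ℝ, 0 < M ∧ B ⊆ Metric.closedBall 0 M)
    (hthick : ∃ δ : ℝ, 0 < δ ∧ ∀ z ∈ B, Metric.closedBall z δ ⊆ B) :
    ∃ ε > 0, ∀ g : K[X], g.natDegree = d →
      (∀ k ≤ d, ‖f.coeff k - g.coeff k‖ < ε) → JuliaConjugate f g := by
  have hK : ∀ r > 0, ∃ x : K, x ≠ 0 ∧ ‖x‖ < r := by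
    intro r hr
    obtain ⟨q, hq0, hq⟩ := NormedField.exists_norm_lt ℚ_[p] hr
    refine ⟨algebraMap ℚ_[p] K q, ?_, by rwa [hext]⟩
    rw [← norm_pos_iff, hext]
    exact hq0
  obtain ⟨lam, hlam, hexp⟩ := hexp
  obtain ⟨M, -, hM⟩ := hbdd
  obtain ⟨δ, hδ, hthick⟩ := hthick
  have hf0 : f ≠ 0 := by
    rintro rfl
    rw [natDegree_zero] at hdeg
    omega
  obtain ⟨c, hc⟩ : ∃ c, c = ‖f.coeff d‖ := ⟨_, rfl⟩
  have hc0 : 0 < c := by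
    rw [hc, norm_pos_iff, ← hdeg]
    exact leadingCoeff_ne_zero.2 hf0
  obtain ⟨C, hC⟩ : ∃ C, ∀ k ≤ d, ‖f.coeff k‖ ≤ C :=
    ⟨∑ k ∈ Finset.range (d + 1), ‖f.coeff k‖, fun k hk =>
      Finset.single_le_sum (f := fun k => ‖f.coeff k‖) (fun _ _ => norm_nonneg _)
        (Finset.mem_range.2 (Nat.lt_succ_of_le hk))⟩
  have hcC : c ≤ C := hc ▸ hC d le_rfl
  have hC0 : 0 < C := hc0.trans_le hcC
  obtain ⟨R, hR1, hRM, hRC, hRc⟩ : ∃ R : ℝ, 1 ≤ R ∧ M ≤ R ∧ C < c * R ∧ 1 ≤ c * R := by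
    refine ⟨max (max 1 M) ((C + 1) / c), ?_, ?_, ?_, ?_⟩
    · exact (le_max_left _ _).trans (le_max_left _ _)
    · exact (le_max_right _ _).trans (le_max_left _ _)
    all_goals
      have h1 : c * ((C + 1) / c) ≤ c * max (max 1 M) ((C + 1) / c) := by
        gcongr; exact le_max_right _ _
      rw [mul_div_cancel₀ _ hc0.ne'] at h1
      linarith
  have hR0 : 0 < R := one_pos.trans_le hR1
  have hBR : ∀ z ∈ B, ‖z‖ ≤ R := fun z hz => (mem_closedBall_zero_iff.1 (hM hz)).trans hRM
  obtain ⟨η, hη, hηδ, hηC⟩ : ∃ η : ℝ, 0 < η ∧ η ≤ δ ∧ C * R ^ d * η ≤ 1 := by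
    refine ⟨min δ (1 / (C * R ^ d)), by positivity, min_le_left _ _, ?_⟩
    calc C * R ^ d * min δ (1 / (C * R ^ d)) ≤ C * R ^ d * (1 / (C * R ^ d)) := by
          gcongr; exact min_le_right _ _
      _ = 1 := by field_simp
  obtain ⟨ε, hε, hεc, hεη, hεone⟩ :
      ∃ ε : ℝ, 0 < ε ∧ ε ≤ c ∧ ε * R ^ d ≤ η ∧ ε * R ^ d ≤ 1 := by
    refine ⟨min c (min η 1 / R ^ d), by positivity, min_le_left _ _, ?_⟩
    rw [← le_min_iff]
    exact (le_div_iff₀ (by positivity)).1 (min_le_right _ _)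
  have hexpanding : ∀ g : K[X], g.natDegree = d → (∀ k ≤ d, ‖f.coeff k - g.coeff k‖ < ε) →
      ExpandingOn B d C R lam η g := by
    intro g hg hfg
    exact expandingOn_of_close hd hdeg hg hc hC hR1 hRC hRc hBR hlam hη (by linarith)
      (fun z hz w hw => hthick z hz (by
        rw [Metric.mem_closedBall, dist_eq_norm]; exact hw.trans hηδ))
      hexp (fun z hz => hinv hz) hεc hεη (by linarith) hfg
  refine ⟨ε, hε, fun g hg hfg => ?_⟩
  have hF := hexpanding f hdeg fun k _ => by simpa using hε
  have hG := hexpanding g hg hfg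
  refine hF.juliaConjugate hG hB hK fun z hz => ?_
  exact (norm_eval_sub_eval_le hdeg.le hg.le hε.le hfg hR1 (hBR z hz)).trans hεη
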